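/- Let n ≥ 1 be an integer and a a rational number with a + n ≠ 0. Then the matrix M(a,n) is invertible over ℚ, and its inverse equals (a+n)⁻¹ • N(a,n). -/

import Mathlib

/-- The rational linking matrix of the DGS surgery link for contact +n surgery
on a Legendrian knot with rational Thurston–Bennequin number `a`. -/
def Mmat (n : ℕ) (a : ℚ) : Matrix (Fin n) (Fin n) ℚ :=
  fun i j =>
    if (i : ℕ) = 0 then (if (j : ℕ) = 0 then a + 1 else a)
    else if (j : ℕ) = 0 then a
    else if i = j then a - 2 else a - 1

/-- The claimed (a+n)·M⁻¹ matrix. -/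
def Nmat (n : ℕ) (a : ℚ) : Matrix (Fin n) (Fin n) ℚ :=
  fun i j =>
    if (i : ℕ) = 0 then (if (j : ℕ) = 0 then (n : ℚ) - ((n : ℚ) - 1) * a else a)
    else if (j : ℕ) = 0 then a
    else if i = j then 1 - a - (n : ℚ) else 1

theorem Mmat_mul_Nmat_succ (m : ℕ) (a : ℚ) :
    Mmat (m + 1) a * Nmat (m + 1) a = (a + ((m + 1 : ℕ) : ℚ)) • (1 : Matrix (Fin (m + 1)) (Fin (m + 1)) ℚ) := by
  have hM (i k : Fin m) : (if i = k then a - 2 else a - 1) = (a - 1) - if i = k then 1 else 0 := by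
    split_ifs <;> ring
  have hN (k j : Fin m) : (if k = j then 1 - a - ((m : ℚ) + 1) else 1) =
      1 - if k = j then a + (m + 1) else 0 := by
    split_ifs <;> ring
  ext i j
  rw [Matrix.mul_apply, Fin.sum_univ_succ]
  refine Fin.cases ?_ (fun i => ?_) i <;> refine Fin.cases ?_ (fun j => ?_) j
  · simp [Mmat, Nmat]
    ring
  · simp [Mmat, Nmat, hN, mul_sub, Finset.sum_sub_distrib,
      (Fin.succ_ne_zero _).symm]
    ring
  · simp [Mmat, Nmat, hM, sub_mul, Finset.sum_sub_distrib]
    ring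
  · simp [Mmat, Nmat, Matrix.one_apply, hM, hN, mul_sub, sub_mul, Finset.sum_sub_distrib]
    split_ifs <;> ring

theorem Mmat_isUnit_and_inv (n : ℕ) (hn : 1 ≤ n) (a : ℚ) (h : a + (n : ℚ) ≠ 0) :
    IsUnit (Mmat n a) ∧ (Mmat n a)⁻¹ = (a + (n : ℚ))⁻¹ • Nmat n a := by
  obtain ⟨m, rfl⟩ := Nat.exists_eq_add_of_le' hn
  have hmul : Mmat (m + 1) a * ((a + ((m + 1 : ℕ) : ℚ))⁻¹ • Nmat (m + 1) a) = 1 := by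
    rw [Matrix.mul_smul, Mmat_mul_Nmat_succ, inv_smul_smul₀ h]
  exact ⟨IsUnit.of_mul_eq_one _ hmul, Matrix.inv_eq_right_inv hmul⟩
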